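/- arXiv:2203.10674 — 6 statements merged into one kernel-verified Lean document; each statement's English description precedes it below -/
import Mathlib

section
/- Let X be a measurable space, S ⊆ X a measurable set, p_r and p_c probability measures on X with p_r(X∖S) = 0 and p_c(S) = 0, α ∈ (0,1), p = α·p_r + (1−α)·p_c, w ∈ ℝ with 1 ≤ w and w·α < 1, W(x) = w for x ∈ S and W(x) = (1−wα)/(1−α) for x ∉ S, and q = (wα)·p_r + (1−wα)·p_c. Let p̂'_r, p̂'_c be probability measures with p̂'_r(X∖S) = 0 and p̂'_c(S) = 0, α̂ ∈ [0,1], p̂ = α̂·p̂'_r + (1−α̂)·p̂'_c, s = w·α̂ + (1−wα)(1−α̂)/(1−α) with s > 0, and q̂ = (wα̂/s)·p̂'_r + ((1−wα)(1−α̂)/(s(1−α)))·p̂'_c. Then for every measurable function D : X → (0,1) such that log D and log(1−D) are integrable with respect to p, p̂, q, and q̂, the weighted Jensen–Shannon GAN loss equals the unweighted loss on the reweighted distributions: ∫ W(x)·log D(x) dp(x) + (1/s)·∫ W(x)·log(1−D(x)) dp̂(x) = ∫ log D(x) dq(x) + ∫ log(1−D(x)) dq̂(x). -/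
open MeasureTheory
open scoped ENNReal Classical

/-- The integral against a nonnegative combination of two measures is the combination of the
integrals. -/
theorem integral_ofReal_smul_add_ofReal_smul {X : Type*} [MeasurableSpace X]
    {μ ν : Measure X} {a b : ℝ} (ha : 0 ≤ a) (hb : 0 ≤ b) {f : X → ℝ}
    (hf : Integrable f (ENNReal.ofReal a • μ + ENNReal.ofReal b • ν)) :
    ∫ x, f x ∂(ENNReal.ofReal a • μ + ENNReal.ofReal b • ν) =
      a * ∫ x, f x ∂μ + b * ∫ x, f x ∂ν := by
  obtain ⟨hμ, hν⟩ := integrable_add_measure.1 hf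
  rw [integral_add_measure hμ hν, integral_smul_measure, integral_smul_measure,
    ENNReal.toReal_ofReal ha, ENNReal.toReal_ofReal hb, smul_eq_mul, smul_eq_mul]

/-- Weighting the integrand by a function equal to `c` almost everywhere for `μ` and to `d` almost
everywhere for `ν` scales the two terms of the integral against a combination of `μ` and `ν`. -/
theorem integral_mul_ofReal_smul_add_ofReal_smul {X : Type*} [MeasurableSpace X]
    {μ ν : Measure X} {a b c d : ℝ} (ha : 0 ≤ a) (hb : 0 ≤ b) {W f : X → ℝ}
    (hWμ : ∀ᵐ x ∂μ, W x = c) (hWν : ∀ᵐ x ∂ν, W x = d)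
    (hf : Integrable f (ENNReal.ofReal a • μ + ENNReal.ofReal b • ν)) :
    ∫ x, W x * f x ∂(ENNReal.ofReal a • μ + ENNReal.ofReal b • ν) =
      a * (c * ∫ x, f x ∂μ) + b * (d * ∫ x, f x ∂ν) := by
  obtain ⟨hμ, hν⟩ := integrable_add_measure.1 hf
  have eμ : (fun x => W x * f x) =ᵐ[μ] fun x => c * f x := by
    filter_upwards [hWμ] with x hx
    rw [hx]
  have eν : (fun x => W x * f x) =ᵐ[ν] fun x => d * f x := by
    filter_upwards [hWν] with x hx
    rw [hx]
  have hWf : Integrable (fun x => W x * f x) (ENNReal.ofReal a • μ + ENNReal.ofReal b • ν) :=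
    integrable_add_measure.2
      ⟨(hμ.const_mul c).congr (Measure.ae_smul_measure eμ.symm _),
        (hν.const_mul d).congr (Measure.ae_smul_measure eν.symm _)⟩
  rw [integral_ofReal_smul_add_ofReal_smul ha hb hWf, integral_congr_ae eμ, integral_congr_ae eν,
    integral_const_mul, integral_const_mul]

/-- Proposition 2 (Jensen–Shannon GAN loss): the weighted JS GAN loss equals the
unweighted loss on the reweighted distributions. -/
theorem weighted_js_gan_loss_eq
    {X : Type*} [MeasurableSpace X] (S : Set X) (hS : MeasurableSet S)
    (pr pc phr phc : Measure X)
    [IsProbabilityMeasure pr] [IsProbabilityMeasure pc]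
    [IsProbabilityMeasure phr] [IsProbabilityMeasure phc]
    (hpr : pr Sᶜ = 0) (hpc : pc S = 0) (hphr : phr Sᶜ = 0) (hphc : phc S = 0)
    (α αh w s : ℝ) (hα : α ∈ Set.Ioo (0:ℝ) 1) (hαh : αh ∈ Set.Icc (0:ℝ) 1)
    (hw1 : 1 ≤ w) (hwα : w * α < 1)
    (hs : s = w * αh + (1 - w * α) * (1 - αh) / (1 - α)) (hspos : 0 < s)
    (p q ph qh : Measure X)
    (hp : p = ENNReal.ofReal α • pr + ENNReal.ofReal (1 - α) • pc)
    (hq : q = ENNReal.ofReal (w * α) • pr + ENNReal.ofReal (1 - w * α) • pc)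
    (hph : ph = ENNReal.ofReal αh • phr + ENNReal.ofReal (1 - αh) • phc)
    (hqh : qh = ENNReal.ofReal (w * αh / s) • phr +
      ENNReal.ofReal ((1 - w * α) * (1 - αh) / (s * (1 - α))) • phc)
    (W : X → ℝ) (hW : ∀ x, W x = if x ∈ S then w else (1 - w * α) / (1 - α))
    (D : X → ℝ) (hD : Measurable D) (hD01 : ∀ x, D x ∈ Set.Ioo (0:ℝ) 1)
    (hint1 : ∀ μ ∈ ({p, ph, q, qh} : Set (Measure X)),
      Integrable (fun x => Real.log (D x)) μ)
    (hint2 : ∀ μ ∈ ({p, ph, q, qh} : Set (Measure X)),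
      Integrable (fun x => Real.log (1 - D x)) μ) :
    (∫ x, W x * Real.log (D x) ∂p) + (1 / s) * ∫ x, W x * Real.log (1 - D x) ∂ph =
      (∫ x, Real.log (D x) ∂q) + ∫ x, Real.log (1 - D x) ∂qh := by
  obtain ⟨hα0, hα1⟩ := hα
  obtain ⟨hαh0, hαh1⟩ := hαh
  have h1α : 0 < 1 - α := sub_pos.2 hα1
  have h1wα : 0 < 1 - w * α := sub_pos.2 hwα
  have h1αh : 0 ≤ 1 - αh := sub_nonneg.2 hαh1
  have hw : 0 ≤ w := zero_le_one.trans hw1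
  have hWS : ∀ μ : Measure X, μ Sᶜ = 0 → ∀ᵐ x ∂μ, W x = w := fun μ hμ => by
    filter_upwards [mem_ae_iff.2 hμ] with x hx
    rw [hW, if_pos hx]
  have hWSc : ∀ μ : Measure X, μ S = 0 → ∀ᵐ x ∂μ, W x = (1 - w * α) / (1 - α) := fun μ hμ => by
    filter_upwards [measure_eq_zero_iff_ae_notMem.1 hμ] with x hx
    rw [hW, if_neg hx]
  have ip := hint1 p (by simp)
  have iq := hint1 q (by simp)
  have iph := hint2 ph (by simp)
  have iqh := hint2 qh (by simp)
  rw [hp] at ip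
  rw [hq] at iq
  rw [hph] at iph
  rw [hqh] at iqh
  rw [hp, hq, hph, hqh,
    integral_mul_ofReal_smul_add_ofReal_smul hα0.le h1α.le (hWS pr hpr) (hWSc pc hpc) ip,
    integral_mul_ofReal_smul_add_ofReal_smul hαh0 h1αh (hWS phr hphr) (hWSc phc hphc) iph,
    integral_ofReal_smul_add_ofReal_smul (by positivity) h1wα.le iq,
    integral_ofReal_smul_add_ofReal_smul (by positivity) (by positivity) iqh]
  field_simp
end

section
/- Let X be a measurable space, S ⊆ X a measurable set, p_r and p_c probability measures on X with p_r(X∖S) = 0 and p_c(S) = 0, α ∈ (0,1), p = α·p_r + (1−α)·p_c, w ∈ ℝ with 1 ≤ w and w·α < 1, W(x) = w for x ∈ S and W(x) = (1−wα)/(1−α) for x ∉ S, and q = (wα)·p_r + (1−wα)·p_c. Let p̂'_r, p̂'_c be probability measures with p̂'_r(X∖S) = 0 and p̂'_c(S) = 0, α̂ ∈ [0,1], p̂ = α̂·p̂'_r + (1−α̂)·p̂'_c, s = w·α̂ + (1−wα)(1−α̂)/(1−α) with s > 0, and q̂ = (wα̂/s)·p̂'_r + ((1−wα)(1−α̂)/(s(1−α)))·p̂'_c.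 Then for every measurable function D : X → ℝ that is integrable with respect to p, p̂, q, and q̂, the weighted Wasserstein GAN loss equals the unweighted loss on the reweighted distributions: ∫ W(x)·D(x) dp(x) − (1/s)·∫ W(x)·D(x) dp̂(x) = ∫ D(x) dq(x) − ∫ D(x) dq̂(x). -/
open MeasureTheory
open scoped ENNReal Classical

/-- If the weight `W` is almost everywhere the constant `u` for `μ` and `v` for `ν`, then the
`W`-weighted integral over the mixture `a μ + b ν` is the combination with weights `a u`, `b v`. -/
theorem integral_weight_mul_mixture {X : Type*} [MeasurableSpace X] {μ ν : Measure X}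
    {a b u v : ℝ} (ha : 0 ≤ a) (hb : 0 ≤ b) {W D : X → ℝ}
    (hWμ : ∀ᵐ x ∂μ, W x = u) (hWν : ∀ᵐ x ∂ν, W x = v)
    (hD : Integrable D (ENNReal.ofReal a • μ + ENNReal.ofReal b • ν)) :
    ∫ x, W x * D x ∂(ENNReal.ofReal a • μ + ENNReal.ofReal b • ν) =
      a * u * ∫ x, D x ∂μ + b * v * ∫ x, D x ∂ν := by
  have hμ : (fun x => u * D x) =ᵐ[μ] fun x => W x * D x := by
    filter_upwards [hWμ] with x hx using by rw [hx]
  have hν : (fun x => v * D x) =ᵐ[ν] fun x => W x * D x := by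
    filter_upwards [hWν] with x hx using by rw [hx]
  rw [integral_add_measure
      ((hD.left_of_add_measure.const_mul u).congr (Measure.ae_smul_measure hμ _))
      ((hD.right_of_add_measure.const_mul v).congr (Measure.ae_smul_measure hν _)),
    integral_smul_measure, integral_smul_measure, ← integral_congr_ae hμ,
    ← integral_congr_ae hν, integral_const_mul, integral_const_mul,
    ENNReal.toReal_ofReal ha, ENNReal.toReal_ofReal hb, smul_eq_mul, smul_eq_mul]
  ring

/-- The integral over the mixture `a μ + b ν` is the corresponding combination of integrals. -/
theorem integral_mixture {X : Type*} [MeasurableSpace X] {μ ν : Measure X}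
    {a b : ℝ} (ha : 0 ≤ a) (hb : 0 ≤ b) {D : X → ℝ}
    (hD : Integrable D (ENNReal.ofReal a • μ + ENNReal.ofReal b • ν)) :
    ∫ x, D x ∂(ENNReal.ofReal a • μ + ENNReal.ofReal b • ν) =
      a * ∫ x, D x ∂μ + b * ∫ x, D x ∂ν := by
  simpa using integral_weight_mul_mixture (W := fun _ => 1) (u := 1) (v := 1) ha hb
    (by simp) (by simp) hD

/-- Proposition 2 (Wasserstein GAN loss): the weighted Wasserstein GAN loss equals the
unweighted loss on the reweighted distributions. -/
theorem weighted_w_gan_loss_eq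
    {X : Type*} [MeasurableSpace X] (S : Set X) (hS : MeasurableSet S)
    (pr pc phr phc : Measure X)
    [IsProbabilityMeasure pr] [IsProbabilityMeasure pc]
    [IsProbabilityMeasure phr] [IsProbabilityMeasure phc]
    (hpr : pr Sᶜ = 0) (hpc : pc S = 0) (hphr : phr Sᶜ = 0) (hphc : phc S = 0)
    (α αh w s : ℝ) (hα : α ∈ Set.Ioo (0:ℝ) 1) (hαh : αh ∈ Set.Icc (0:ℝ) 1)
    (hw1 : 1 ≤ w) (hwα : w * α < 1)
    (hs : s = w * αh + (1 - w * α) * (1 - αh) / (1 - α)) (hspos : 0 < s)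
    (p q ph qh : Measure X)
    (hp : p = ENNReal.ofReal α • pr + ENNReal.ofReal (1 - α) • pc)
    (hq : q = ENNReal.ofReal (w * α) • pr + ENNReal.ofReal (1 - w * α) • pc)
    (hph : ph = ENNReal.ofReal αh • phr + ENNReal.ofReal (1 - αh) • phc)
    (hqh : qh = ENNReal.ofReal (w * αh / s) • phr +
      ENNReal.ofReal ((1 - w * α) * (1 - αh) / (s * (1 - α))) • phc)
    (W : X → ℝ) (hW : ∀ x, W x = if x ∈ S then w else (1 - w * α) / (1 - α))
    (D : X → ℝ) (hD : Measurable D)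
    (hint : ∀ μ ∈ ({p, ph, q, qh} : Set (Measure X)), Integrable D μ) :
    (∫ x, W x * D x ∂p) - (1 / s) * ∫ x, W x * D x ∂ph =
      (∫ x, D x ∂q) - ∫ x, D x ∂qh := by
  obtain ⟨hα0, hα1⟩ := hα
  obtain ⟨hαh0, hαh1⟩ := hαh
  have hw0 : 0 ≤ w := by linarith
  have hβ : 0 < 1 - α := by linarith
  have hγ : 0 ≤ 1 - w * α := by linarith
  have hβh : 0 ≤ 1 - αh := by linarith
  have rare (μ : Measure X) (h : μ Sᶜ = 0) : ∀ᵐ x ∂μ, W x = w := by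
    filter_upwards [mem_ae_iff.2 h] with x hx
    rw [hW, if_pos hx]
  have common (μ : Measure X) (h : μ S = 0) : ∀ᵐ x ∂μ, W x = (1 - w * α) / (1 - α) := by
    filter_upwards [compl_mem_ae_iff.2 h] with x hx
    rw [hW, if_neg hx]
  have ip := hint p (by simp)
  have iph := hint ph (by simp)
  have iq := hint q (by simp)
  have iqh := hint qh (by simp)
  rw [hp] at ip ⊢
  rw [hph] at iph ⊢
  rw [hq] at iq ⊢
  rw [hqh] at iqh ⊢
  rw [integral_weight_mul_mixture hα0.le hβ.le (rare pr hpr) (common pc hpc) ip,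
    integral_weight_mul_mixture hαh0 hβh (rare phr hphr) (common phc hphc) iph,
    integral_mixture (by positivity) hγ iq, integral_mixture (by positivity) (by positivity) iqh]
  have hs0 := hspos.ne'
  have hβ0 := hβ.ne'
  field_simp
end

section
/- Let X be a measurable space, S ⊆ X a measurable set, p_r and p_c probability measures on X with p_r(X∖S) = 0 and p_c(S) = 0, α ∈ (0,1), p = α·p_r + (1−α)·p_c, and let p̂'_r, p̂'_c be probability measures with p̂'_r(X∖S) = 0 and p̂'_c(S) = 0, α̂ ∈ [0,1], p̂ = α̂·p̂'_r + (1−α̂)·p̂'_c. Let w ∈ ℝ satisfy 1 ≤ w and w·α < 1, let s = w·α̂ + (1−wα)(1−α̂)/(1−α) (which is positive), q = (wα)·p_r + (1−wα)·p_c, and q̂ = (wα̂/s)·p̂'_r + ((1−wα)(1−α̂)/(s(1−α)))·p̂'_c. Then q = q̂ if and only if p = p̂; in particular α̂ = α, p̂'_r = p_r, and p̂'_c = p_c whenever q = q̂. -/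
open MeasureTheory
open scoped ENNReal Classical

/-- A mixture of two measures carried by `S` and `Sᶜ` restricts on `S` to its first component. -/
theorem restrict_smul_add_smul_eq_left {X : Type*} [MeasurableSpace X] {S : Set X}
    {μ ν : Measure X} (hμ : μ Sᶜ = 0) (hν : ν S = 0) (a b : ℝ≥0∞) :
    (a • μ + b • ν).restrict S = a • μ := by
  have h : μ.restrict S = μ := Measure.restrict_eq_self_of_ae_mem (mem_ae_iff.mpr hμ)
  rw [Measure.restrict_add, Measure.restrict_smul, Measure.restrict_smul, h,
    Measure.restrict_eq_zero.mpr hν, smul_zero, add_zero]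

/-- A positive multiple of a probability measure determines both the factor and the measure. -/
theorem ofReal_smul_probabilityMeasure_inj {X : Type*} [MeasurableSpace X]
    {μ ν : Measure X} [IsProbabilityMeasure μ] [IsProbabilityMeasure ν] {a b : ℝ}
    (ha : 0 < a) (hb : 0 ≤ b) (h : ENNReal.ofReal a • μ = ENNReal.ofReal b • ν) :
    b = a ∧ ν = μ := by
  have hab : b = a := by
    have h1 := congrArg (fun m : Measure X => m Set.univ) h
    simp only [Measure.smul_apply, measure_univ, smul_eq_mul, mul_one] at h1
    exact ((ENNReal.ofReal_eq_ofReal_iff ha.le hb).mp h1).symm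
  subst hab
  refine ⟨rfl, Measure.ext fun t _ => ?_⟩
  have h1 := congrArg (fun m : Measure X => m t) h
  simp only [Measure.smul_apply, smul_eq_mul] at h1
  exact ((ENNReal.mul_right_inj (ENNReal.ofReal_pos.mpr ha).ne' ENNReal.ofReal_ne_top).mp h1).symm

/-- A mixture, with positive weights, of probability measures carried by `S` and `Sᶜ` determines
its weights and components. -/
theorem ofReal_smul_add_ofReal_smul_inj {X : Type*} [MeasurableSpace X] {S : Set X}
    {μ ν μ' ν' : Measure X} [IsProbabilityMeasure μ] [IsProbabilityMeasure ν]
    [IsProbabilityMeasure μ'] [IsProbabilityMeasure ν']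
    (hμ : μ Sᶜ = 0) (hν : ν S = 0) (hμ' : μ' Sᶜ = 0) (hν' : ν' S = 0)
    {a b a' b' : ℝ} (ha : 0 < a) (hb : 0 < b) (ha' : 0 ≤ a') (hb' : 0 ≤ b')
    (h : ENNReal.ofReal a • μ + ENNReal.ofReal b • ν =
      ENNReal.ofReal a' • μ' + ENNReal.ofReal b' • ν') :
    (a' = a ∧ μ' = μ) ∧ (b' = b ∧ ν' = ν) := by
  constructor
  · refine ofReal_smul_probabilityMeasure_inj ha ha' ?_
    rw [← restrict_smul_add_smul_eq_left hμ hν, h, restrict_smul_add_smul_eq_left hμ' hν']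
  · refine ofReal_smul_probabilityMeasure_inj hb hb' ?_
    rw [← restrict_smul_add_smul_eq_left (S := Sᶜ) (by rwa [compl_compl]) hμ,
      add_comm, h, add_comm,
      restrict_smul_add_smul_eq_left (by rwa [compl_compl]) hμ']

/-- The reweighted distance is zero iff the original distance is zero: q = q̂ iff p = p̂;
in particular α̂ = α, p̂'_r = p_r, and p̂'_c = p_c whenever q = q̂. -/
theorem reweighted_eq_iff_eq
    {X : Type*} [MeasurableSpace X] (S : Set X) (hS : MeasurableSet S)
    (pr pc : Measure X) [IsProbabilityMeasure pr] [IsProbabilityMeasure pc]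
    (hpr : pr Sᶜ = 0) (hpc : pc S = 0)
    (α : ℝ) (hα : α ∈ Set.Ioo (0:ℝ) 1)
    (p : Measure X)
    (hp : p = ENNReal.ofReal α • pr + ENNReal.ofReal (1 - α) • pc)
    (phr phc : Measure X) [IsProbabilityMeasure phr] [IsProbabilityMeasure phc]
    (hphr : phr Sᶜ = 0) (hphc : phc S = 0)
    (αh : ℝ) (hαh : αh ∈ Set.Icc (0:ℝ) 1)
    (ph : Measure X)
    (hph : ph = ENNReal.ofReal αh • phr + ENNReal.ofReal (1 - αh) • phc)
    (w s : ℝ) (hw1 : 1 ≤ w) (hwα : w * α < 1)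
    (hs : s = w * αh + (1 - w * α) * (1 - αh) / (1 - α)) (hspos : 0 < s)
    (q qh : Measure X)
    (hq : q = ENNReal.ofReal (w * α) • pr + ENNReal.ofReal (1 - w * α) • pc)
    (hqh : qh = ENNReal.ofReal (w * αh / s) • phr +
      ENNReal.ofReal ((1 - w * α) * (1 - αh) / (s * (1 - α))) • phc) :
    (q = qh ↔ p = ph) ∧ (q = qh → αh = α ∧ phr = pr ∧ phc = pc) := by
  obtain ⟨hα0, hα1⟩ := hα
  obtain ⟨hαh0, hαh1⟩ := hαh
  have hw0 : 0 < w := by linarith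
  have h1α : 0 < 1 - α := by linarith
  have h1αh : 0 ≤ 1 - αh := by linarith
  have h1wα : 0 < 1 - w * α := by linarith
  have key : q = qh → αh = α ∧ phr = pr ∧ phc = pc := by
    intro h
    rw [hq, hqh] at h
    obtain ⟨⟨h1, h2⟩, h3, h4⟩ := ofReal_smul_add_ofReal_smul_inj hpr hpc hphr hphc
      (by positivity) h1wα (by positivity) (by positivity) h
    rw [div_eq_iff hspos.ne', mul_assoc] at h1
    rw [div_eq_iff (by positivity)] at h3
    have h5 := mul_left_cancel₀ hw0.ne' h1
    have h6 := mul_left_cancel₀ h1wα.ne' h3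
    have hs1 : s = 1 := by linarith
    exact ⟨by rw [h5, hs1, mul_one], h2, h4⟩
  refine ⟨⟨fun h => ?_, fun h => ?_⟩, key⟩
  · obtain ⟨rfl, rfl, rfl⟩ := key h
    rw [hp, hph]
  · rw [hp, hph] at h
    obtain ⟨⟨rfl, rfl⟩, -, rfl⟩ := ofReal_smul_add_ofReal_smul_inj hpr hpc hphr hphc
      hα0 h1α hαh0 h1αh h
    rw [mul_div_cancel_right₀ _ h1α.ne', add_sub_cancel] at hs
    rw [hq, hqh, hs, div_one, one_mul, mul_div_cancel_right₀ _ h1α.ne']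
end

section
/- Let X be a measurable space, A ⊆ X a measurable set, α ∈ (0,1), and w ∈ ℝ with 0 < w and w·α < 1. Define the weight function W_A(x) = w for x ∈ A and W_A(x) = (1−wα)/(1−α) for x ∉ A, and for a probability measure μ on X define T_A(μ) to be the probability measure with density W_A with respect to μ, normalized by its total mass (which is strictly positive). Then the map μ ↦ T_A(μ) is injective on probability measures: T_A(μ₁) = T_A(μ₂) implies μ₁ = μ₂. -/
open MeasureTheory
open scoped ENNReal Classical

/-- Reweighting by a positive finite measurable density and normalizing by the total mass is
injective on probability measures for which the total mass is positive and finite. -/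
theorem eq_of_normalized_withDensity_eq {X : Type*} [MeasurableSpace X] {f : X → ℝ≥0∞}
    (hf : Measurable f) (hf0 : ∀ x, f x ≠ 0) (hft : ∀ x, f x ≠ ∞)
    {μ ν : Measure X} [IsProbabilityMeasure μ] [IsProbabilityMeasure ν]
    (hμ0 : μ.withDensity f Set.univ ≠ 0) (hμt : μ.withDensity f Set.univ ≠ ∞)
    (h : (μ.withDensity f Set.univ)⁻¹ • μ.withDensity f =
      (ν.withDensity f Set.univ)⁻¹ • ν.withDensity f) : μ = ν := by
  have hsmul : (μ.withDensity f Set.univ)⁻¹ • μ = (ν.withDensity f Set.univ)⁻¹ • ν := by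
    have h' := congrArg (fun ρ : Measure X => ρ.withDensity fun x => (f x)⁻¹) h
    simpa only [withDensity_smul_measure, withDensity_inv_same hf (ae_of_all _ hf0)
      (ae_of_all _ hft)] using h'
  have hc : (μ.withDensity f Set.univ)⁻¹ = (ν.withDensity f Set.univ)⁻¹ := by
    simpa only [Measure.smul_apply, measure_univ, smul_eq_mul, mul_one] using
      congrArg (fun ρ : Measure X => ρ Set.univ) hsmul
  rw [← hc] at hsmul
  ext s
  have hs := congrArg (fun ρ : Measure X => ρ s) hsmul
  simp only [Measure.smul_apply, smul_eq_mul] at hs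
  exact (ENNReal.mul_right_inj (ENNReal.inv_ne_zero.2 hμt) (ENNReal.inv_ne_top.2 hμ0)).1 hs

/-- Reweighting a probability measure by the strictly positive weight function W_A and
renormalizing by its total mass (which is strictly positive) is an injective operation on
probability measures. -/
theorem reweighting_injective
    {X : Type*} [MeasurableSpace X] (A : Set X) (hA : MeasurableSet A)
    (α w : ℝ) (hα : α ∈ Set.Ioo (0:ℝ) 1) (hw : 0 < w) (hwα : w * α < 1)
    (WA : X → ℝ) (hWA : ∀ x, WA x = if x ∈ A then w else (1 - w * α) / (1 - α))
    (μ₁ μ₂ : Measure X) [IsProbabilityMeasure μ₁] [IsProbabilityMeasure μ₂] :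
    0 < (μ₁.withDensity fun x => ENNReal.ofReal (WA x)) Set.univ ∧
    0 < (μ₂.withDensity fun x => ENNReal.ofReal (WA x)) Set.univ ∧
    ((((μ₁.withDensity fun x => ENNReal.ofReal (WA x)) Set.univ)⁻¹ •
        μ₁.withDensity (fun x => ENNReal.ofReal (WA x)) =
      ((μ₂.withDensity fun x => ENNReal.ofReal (WA x)) Set.univ)⁻¹ •
        μ₂.withDensity (fun x => ENNReal.ofReal (WA x))) → μ₁ = μ₂) := by
  have hv : 0 < (1 - w * α) / (1 - α) := div_pos (by linarith) (by linarith [hα.2])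
  have hpos : ∀ x, 0 < WA x := fun x => by
    rw [hWA]
    split_ifs <;> assumption
  have hmeas : Measurable fun x => ENNReal.ofReal (WA x) := by
    rw [funext hWA]
    exact (Measurable.ite hA measurable_const measurable_const).ennreal_ofReal
  have hf0 : ∀ x, ENNReal.ofReal (WA x) ≠ 0 := fun x => (ENNReal.ofReal_pos.2 (hpos x)).ne'
  have mass_pos : ∀ μ : Measure X, IsProbabilityMeasure μ →
      0 < (μ.withDensity fun x => ENNReal.ofReal (WA x)) Set.univ := fun μ _ => by
    rw [withDensity_apply _ MeasurableSet.univ, Measure.restrict_univ,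
      lintegral_pos_iff_support hmeas, Function.support_eq_univ hf0, measure_univ]
    exact one_pos
  have mass_ne_top : (μ₁.withDensity fun x => ENNReal.ofReal (WA x)) Set.univ ≠ ∞ := by
    rw [withDensity_apply _ MeasurableSet.univ]
    refine ((setLIntegral_mono (g := fun _ => ENNReal.ofReal (max w ((1 - w * α) / (1 - α))))
      measurable_const fun x _ => ENNReal.ofReal_le_ofReal ?_).trans_lt ?_).ne
    · rw [hWA]
      split_ifs
      · exact le_max_left _ _
      · exact le_max_right _ _
    · simp
  exact ⟨mass_pos μ₁ inferInstance, mass_pos μ₂ inferInstance,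
    eq_of_normalized_withDensity_eq hmeas hf0 (fun _ => ENNReal.ofReal_ne_top)
      (mass_pos μ₁ inferInstance).ne' mass_ne_top⟩
end

section
/- Let μ and ν be probability measures on a measurable space X. For each measurable function C : X → [0,1], define the binary cross-entropy classification loss L(C) = ∫ (−log C(x)) dμ(x) + ∫ (−log(1−C(x))) dν(x), taking values in [0, ∞] (with the conventions −log 0 = ∞ and Lebesgue integration of nonnegative extended-real functions). Then the infimum of L(C) over all measurable C : X → [0,1] equals 0 if and only if μ and ν are mutually singular; moreover, when μ ⟂ ν the infimum is attained by the indicator function of a set separating μ from ν. -/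
open MeasureTheory
open scoped ENNReal Classical

/-- The negative logarithm with the convention `-log 0 = ∞`. -/
noncomputable def negLog (t : ℝ) : ℝ≥0∞ := if t = 0 then ⊤ else ENNReal.ofReal (-Real.log t)

lemma measurable_negLog : Measurable negLog :=
  Measurable.ite (measurableSet_singleton 0) measurable_const
    (ENNReal.measurable_ofReal.comp Real.measurable_log.neg)

@[simp] lemma negLog_one : negLog 1 = 0 := by simp [negLog]

lemma ofReal_log_two_le_negLog {t : ℝ} (h₀ : 0 ≤ t) (h : t ≤ 1 / 2) :
    ENNReal.ofReal (Real.log 2) ≤ negLog t := by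
  rcases h₀.eq_or_lt with rfl | ht
  · simp [negLog]
  · rw [negLog, if_neg ht.ne']
    apply ENNReal.ofReal_le_ofReal
    rw [← Real.log_inv]
    exact Real.log_le_log two_pos ((le_inv_comm₀ two_pos ht).2 (by simpa using h))

lemma ofReal_log_two_le_negLog_add {t : ℝ} (h : t ∈ Set.Icc (0 : ℝ) 1) :
    ENNReal.ofReal (Real.log 2) ≤ negLog t + negLog (1 - t) := by
  rcases le_total t (1 / 2) with ht | ht
  · exact le_add_right (ofReal_log_two_le_negLog h.1 ht)
  · exact le_add_left (ofReal_log_two_le_negLog (by linarith [h.2]) (by linarith))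

/-- The cross-entropy loss of any classifier is bounded below by the mass of any common
minorant of the two measures. -/
lemma ofReal_log_two_mul_le_lintegral_negLog_add {X : Type*} [MeasurableSpace X]
    {μ ν ρ : Measure X} (hμ : ρ ≤ μ) (hν : ρ ≤ ν) {C : X → ℝ} (hC : Measurable C)
    (hC' : ∀ x, C x ∈ Set.Icc (0 : ℝ) 1) :
    ENNReal.ofReal (Real.log 2) * ρ Set.univ ≤
      (∫⁻ x, negLog (C x) ∂μ) + ∫⁻ x, negLog (1 - C x) ∂ν :=
  calc
    _ = ∫⁻ _, ENNReal.ofReal (Real.log 2) ∂ρ := (lintegral_const _).symm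
    _ ≤ ∫⁻ x, (negLog (C x) + negLog (1 - C x)) ∂ρ :=
      lintegral_mono fun x => ofReal_log_two_le_negLog_add (hC' x)
    _ = (∫⁻ x, negLog (C x) ∂ρ) + ∫⁻ x, negLog (1 - C x) ∂ρ :=
      lintegral_add_left (measurable_negLog.comp hC) _
    _ ≤ _ := add_le_add (lintegral_mono' hμ le_rfl) (lintegral_mono' hν le_rfl)

lemma lintegral_negLog_indicator_add_eq_zero {X : Type*} [MeasurableSpace X]
    {μ ν : Measure X} {A : Set X} (hμ : μ Aᶜ = 0) (hν : ν A = 0) :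
    (∫⁻ x, negLog (A.indicator (fun _ => (1 : ℝ)) x) ∂μ) +
      ∫⁻ x, negLog (1 - A.indicator (fun _ => (1 : ℝ)) x) ∂ν = 0 := by
  have h₁ : ∀ᵐ x ∂μ, negLog (A.indicator (fun _ => (1 : ℝ)) x) = 0 := by
    filter_upwards [mem_ae_iff.2 hμ] with x hx
    simp [hx]
  have h₂ : ∀ᵐ x ∂ν, negLog (1 - A.indicator (fun _ => (1 : ℝ)) x) = 0 := by
    filter_upwards [measure_eq_zero_iff_ae_notMem.1 hν] with x hx
    simp [hx]
  rw [lintegral_congr_ae h₁, lintegral_congr_ae h₂]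
  simp

/-- The infimum of the binary cross-entropy classification loss over measurable
classifiers C : X → [0,1] equals 0 iff μ and ν are mutually singular; when μ ⟂ ν the
infimum is attained by the indicator of a separating set. The convention −log 0 = ∞ is
encoded by the extended negative-log `nl`. -/
theorem bce_inf_eq_zero_iff_mutuallySingular
    {X : Type*} [MeasurableSpace X] (μ ν : Measure X)
    [IsProbabilityMeasure μ] [IsProbabilityMeasure ν]
    (nl : ℝ → ℝ≥0∞) (hnl : ∀ t, nl t = if t = 0 then ⊤ else ENNReal.ofReal (-Real.log t))
    (L : (X → ℝ) → ℝ≥0∞)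
    (hL : ∀ C : X → ℝ, L C = (∫⁻ x, nl (C x) ∂μ) + ∫⁻ x, nl (1 - C x) ∂ν) :
    ((⨅ (C : X → ℝ) (_ : Measurable C ∧ ∀ x, C x ∈ Set.Icc (0:ℝ) 1), L C) = 0 ↔ μ ⟂ₘ ν) ∧
    (μ ⟂ₘ ν → ∃ A : Set X, MeasurableSet A ∧ μ Aᶜ = 0 ∧ ν A = 0 ∧
      L (A.indicator fun _ => (1:ℝ)) = 0) := by
  obtain rfl : nl = negLog := funext hnl
  have attained : μ ⟂ₘ ν → ∃ A : Set X, MeasurableSet A ∧ μ Aᶜ = 0 ∧ ν A = 0 ∧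
      L (A.indicator fun _ => (1:ℝ)) = 0 := by
    rintro ⟨B, hB, hμ, hν⟩
    refine ⟨Bᶜ, hB.compl, by rwa [compl_compl], hν, ?_⟩
    rw [hL]
    exact lintegral_negLog_indicator_add_eq_zero (by rwa [compl_compl]) hν
  refine ⟨⟨fun h => ?_, fun h => ?_⟩, attained⟩
  · rw [Measure.mutuallySingular_iff_disjoint]
    intro ρ hμ hν
    have hρ : ENNReal.ofReal (Real.log 2) * ρ Set.univ ≤ 0 := by
      rw [← h]
      refine le_iInf₂ fun C hC => ?_
      rw [hL]
      exact ofReal_log_two_mul_le_lintegral_negLog_add hμ hν hC.1 hC.2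
    have hlog : ENNReal.ofReal (Real.log 2) ≠ 0 := by
      simpa using Real.log_pos one_lt_two
    have hρ₀ := (mul_eq_zero.1 (nonpos_iff_eq_zero.1 hρ)).resolve_left hlog
    exact (Measure.measure_univ_eq_zero.1 hρ₀).le
  · obtain ⟨A, hA, -, -, hLA⟩ := attained h
    refine le_antisymm (hLA ▸ iInf₂_le _ ⟨measurable_const.indicator hA, fun x => ?_⟩) zero_le
    by_cases hx : x ∈ A <;> simp [hx]
end

section
/- Let X be a measurable space, S ⊆ X a measurable set, and let p_r, p_c, p'_r, p'_c be probability measures on X with p_r(X∖S) = p'_r(X∖S) = 0 and p_c(S) = p'_c(S) = 0. Let α ∈ (0,1), β ∈ (0,1), and p = α·p_r + (1−α)·p_c. Let d be a function assigning to each pair of probability measures on X a value in [0,∞] such that d(μ, ν) = 0 if and only if μ = ν. For probability measures q_r, q_c on X with q_r ≪ p'_r + p'_c and q_c ≪ p'_r + p'_c, define the classification infimum I(q_r, q_c) as the infimum over measurable C : X → [0,1] of β·∫(−log C) dp'_r + (1−β)·∫(−log(1−C)) dp'_c + α·∫(−log C) dq_r + (1−α)·∫(−log(1−C)) dq_c (in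 [0,∞]), and define the objective J(q_r, q_c) = d(α·q_r + (1−α)·q_c, p) + I(q_r, q_c). Assume p_r ≪ p'_r and p_c ≪ p'_c. Then J(q_r, q_c) = 0 if and only if q_r = p_r and q_c = p_c. -/
open MeasureTheory
open scoped ENNReal Classical

/-- If `ν ≪ μ` and there are pairs of functions, at each point not both small, whose integrals
against `ν` and `μ` respectively are simultaneously arbitrarily small, then `ν = 0`. -/
theorem MeasureTheory.Measure.AbsolutelyContinuous.eq_zero_of_forall_exists_lintegral_le
    {X : Type*} [MeasurableSpace X] {μ ν : Measure X} (h : ν ≪ μ) {c : ℝ≥0∞} (hc : c ≠ 0)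
    (hc' : c ≠ ⊤)
    (H : ∀ ε : ℝ≥0∞, 0 < ε → ∃ f g : X → ℝ≥0∞, Measurable f ∧ Measurable g ∧
      (∀ x, c ≤ f x ∨ c ≤ g x) ∧ ∫⁻ x, f x ∂ν ≤ ε ∧ ∫⁻ x, g x ∂μ ≤ ε) :
    ν = 0 := by
  have hpos (n : ℕ) : (0 : ℝ≥0∞) < 2⁻¹ ^ n := ENNReal.pow_pos (by simp) n
  choose f g hf hg hfg hfi hgi using fun n : ℕ => H (2⁻¹ ^ n) (hpos n)
  have ae_eventually_not_le (ρ : Measure X) (u : ℕ → X → ℝ≥0∞) (hu : ∀ n, Measurable (u n))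
      (hui : ∀ n, ∫⁻ x, u n x ∂ρ ≤ 2⁻¹ ^ n) : ∀ᵐ x ∂ρ, ∀ᶠ n in Filter.atTop, ¬ c ≤ u n x := by
    refine ae_eventually_notMem (s := fun n => {x | c ≤ u n x}) ?_
    refine ne_top_of_le_ne_top (b := ∑' n : ℕ, 2⁻¹ ^ n / c) ?_ (ENNReal.tsum_le_tsum fun n =>
      (meas_ge_le_lintegral_div (hu n).aemeasurable hc hc').trans
        (ENNReal.div_le_div_right (hui n) c))
    simp only [div_eq_mul_inv]
    rw [ENNReal.tsum_mul_right, ENNReal.tsum_geometric]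
    exact ENNReal.mul_ne_top (by simp) (by simpa using hc)
  rw [← ae_eq_bot, ← Filter.eventually_false_iff_eq_bot]
  filter_upwards [ae_eventually_not_le ν f hf hfi, h.ae_le (ae_eventually_not_le μ g hg hgi)] with x hx hy
  obtain ⟨n, hn, hn'⟩ := (hx.and hy).exists
  exact (hfg n x).elim hn hn'

/-- Two mixtures with the same nonzero finite weights whose first components live on `S` and whose
second components live off `S` have equal first components if the mixtures agree. -/
theorem MeasureTheory.Measure.eq_of_smul_add_smul_eq {X : Type*} [MeasurableSpace X] {S : Set X}
    (hS : MeasurableSet S) {a b : ℝ≥0∞} (ha : a ≠ 0) (ha' : a ≠ ⊤) {μ₁ μ₂ ν₁ ν₂ : Measure X}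
    (hμ₁ : μ₁ Sᶜ = 0) (hμ₂ : μ₂ S = 0) (hν₁ : ν₁ Sᶜ = 0) (hν₂ : ν₂ S = 0)
    (h : a • μ₁ + b • μ₂ = a • ν₁ + b • ν₂) : μ₁ = ν₁ := by
  ext A -
  have inter_eq {ρ : Measure X} (hρ : ρ Sᶜ = 0) : ρ (A ∩ S) = ρ A := by
    rw [← measure_inter_add_sdiff A hS, Set.sdiff_eq,
      measure_mono_null Set.inter_subset_right hρ, add_zero]
  have hA := congrArg (fun ρ : Measure X => ρ (A ∩ S)) h
  simp only [Measure.add_apply, Measure.smul_apply, smul_eq_mul, inter_eq hμ₁, inter_eq hν₁,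
    measure_mono_null Set.inter_subset_right hμ₂, measure_mono_null Set.inter_subset_right hν₂,
    mul_zero, add_zero] at hA
  exact (ENNReal.mul_right_inj ha ha').1 hA

/-- Proposition 1 (pointwise form): the generalized ACGAN objective, consisting of a GAN
loss against the full data distribution p plus a classification loss against a possibly
biased labeled distribution (p'_r, p'_c), is zero iff the generated class conditionals
equal the true ones. -/
theorem acgan_objective_zero_iff
    {X : Type*} [MeasurableSpace X] (S : Set X) (hS : MeasurableSet S)
    (pr pc p'r p'c : Measure X)
    [IsProbabilityMeasure pr] [IsProbabilityMeasure pc]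
    [IsProbabilityMeasure p'r] [IsProbabilityMeasure p'c]
    (hpr : pr Sᶜ = 0) (hp'r : p'r Sᶜ = 0) (hpc : pc S = 0) (hp'c : p'c S = 0)
    (α β : ℝ) (hα : α ∈ Set.Ioo (0:ℝ) 1) (hβ : β ∈ Set.Ioo (0:ℝ) 1)
    (p : Measure X) (hp : p = ENNReal.ofReal α • pr + ENNReal.ofReal (1 - α) • pc)
    (d : Measure X → Measure X → ℝ≥0∞)
    (hd : ∀ μ ν : Measure X, IsProbabilityMeasure μ → IsProbabilityMeasure ν →
      (d μ ν = 0 ↔ μ = ν))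
    (nl : ℝ → ℝ≥0∞) (hnl : ∀ t, nl t = if t = 0 then ⊤ else ENNReal.ofReal (-Real.log t))
    (I : Measure X → Measure X → ℝ≥0∞)
    (hI : ∀ qr qc : Measure X, I qr qc =
      ⨅ (C : X → ℝ) (_ : Measurable C ∧ ∀ x, C x ∈ Set.Icc (0:ℝ) 1),
        ENNReal.ofReal β * ∫⁻ x, nl (C x) ∂p'r +
        ENNReal.ofReal (1 - β) * ∫⁻ x, nl (1 - C x) ∂p'c +
        ENNReal.ofReal α * ∫⁻ x, nl (C x) ∂qr +
        ENNReal.ofReal (1 - α) * ∫⁻ x, nl (1 - C x) ∂qc)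
    (J : Measure X → Measure X → ℝ≥0∞)
    (hJ : ∀ qr qc : Measure X, J qr qc =
      d (ENNReal.ofReal α • qr + ENNReal.ofReal (1 - α) • qc) p + I qr qc)
    (hprac : pr ≪ p'r) (hpcac : pc ≪ p'c)
    (qr qc : Measure X) [IsProbabilityMeasure qr] [IsProbabilityMeasure qc]
    (hqr : qr ≪ p'r + p'c) (hqc : qc ≪ p'r + p'c) :
    J qr qc = 0 ↔ qr = pr ∧ qc = pc := by
  have hα0 : ENNReal.ofReal α ≠ 0 := by simpa using hα.1
  have hα1 : ENNReal.ofReal (1 - α) ≠ 0 := by simpa using hα.2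
  have hβ0 : ENNReal.ofReal β ≠ 0 := by simpa using hβ.1
  have hβ1 : ENNReal.ofReal (1 - β) ≠ 0 := by simpa using hβ.2
  have hmix (μ ν : Measure X) [IsProbabilityMeasure μ] [IsProbabilityMeasure ν] :
      IsProbabilityMeasure (ENNReal.ofReal α • μ + ENNReal.ofReal (1 - α) • ν) := ⟨by
    simp [← ENNReal.ofReal_add hα.1.le (sub_nonneg.2 hα.2.le)]⟩
  have hd' := hd _ p (hmix qr qc) (hp ▸ hmix pr pc)
  have hnlm : Measurable nl := by
    rw [funext hnl]
    exact Measurable.ite (measurableSet_singleton 0) measurable_const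
      Real.measurable_log.neg.ennreal_ofReal
  have hnl1 : nl 1 = 0 := by simp [hnl]
  rw [hJ, add_eq_zero, hd', hp]
  constructor
  · rintro ⟨hmixeq, hI0⟩
    have hnl_ge (t : ℝ) (h0 : 0 ≤ t) (ht : t ≤ 1 / 2) : ENNReal.ofReal (Real.log 2) ≤ nl t := by
      rw [hnl]
      split_ifs with h
      · exact le_top
      · refine ENNReal.ofReal_le_ofReal ?_
        rw [← Real.log_inv]
        refine Real.log_le_log two_pos ((le_inv_comm₀ two_pos (h0.lt_of_ne' h)).2 ?_)
        simpa using ht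
    have hlog0 : ENNReal.ofReal (Real.log 2) ≠ 0 := by simpa using Real.log_pos one_lt_two
    have hsmall (ε : ℝ≥0∞) (hε : 0 < ε) : ∃ f g : X → ℝ≥0∞, Measurable f ∧ Measurable g ∧
        (∀ x, ENNReal.ofReal (Real.log 2) ≤ f x ∨ ENNReal.ofReal (Real.log 2) ≤ g x) ∧
        ENNReal.ofReal β * ∫⁻ x, f x ∂p'r + ENNReal.ofReal (1 - β) * ∫⁻ x, g x ∂p'c +
        ENNReal.ofReal α * ∫⁻ x, f x ∂qr + ENNReal.ofReal (1 - α) * ∫⁻ x, g x ∂qc ≤ ε := by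
      rw [← hI0, hI] at hε
      simp only [iInf_lt_iff] at hε
      obtain ⟨C, ⟨hCm, hC⟩, hCε⟩ := hε
      refine ⟨_, _, hnlm.comp hCm, hnlm.comp (hCm.const_sub 1), fun x => ?_, hCε.le⟩
      rcases le_total (C x) (1 / 2) with h | h
      · exact Or.inl (hnl_ge _ (hC x).1 h)
      · exact Or.inr (hnl_ge _ (sub_nonneg.2 (hC x).2) (by linarith))
    have hac {T : Set X} {q μ ρ : Measure X} {a b : ℝ≥0∞} (hT : MeasurableSet T) (hb : b ≠ 0)
        (hq : q ≪ μ + ρ) (hμ : μ T = 0) : (a • q).restrict T ≪ b • ρ := by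
      refine Measure.AbsolutelyContinuous.mk fun A hA hA0 => ?_
      have hρ : ρ A = 0 := by simpa [hb] using hA0
      have : q (A ∩ T) = 0 := hq (by
        simp [measure_mono_null Set.inter_subset_right hμ,
          measure_mono_null Set.inter_subset_left hρ])
      simp [Measure.restrict_apply hA, this]
    have hqrS : qr Sᶜ = 0 := by
      have h0 := (hac (a := ENNReal.ofReal α) hS.compl hβ1 hqr
        hp'r).eq_zero_of_forall_exists_lintegral_le hlog0 ENNReal.ofReal_ne_top fun ε hε => by
          obtain ⟨f, g, hf, hg, hfg, h⟩ := hsmall ε hε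
          refine ⟨f, g, hf, hg, hfg, (setLIntegral_le_lintegral _ _).trans ?_, ?_⟩ <;>
            rw [lintegral_smul_measure, smul_eq_mul]
          · exact (le_add_self.trans le_self_add).trans h
          · exact (le_add_self.trans (le_self_add.trans le_self_add)).trans h
      simpa [hα0, hα.1.not_ge] using h0
    have hqcS : qc S = 0 := by
      have h0 := (hac (a := ENNReal.ofReal (1 - α)) hS hβ0 (add_comm p'r p'c ▸ hqc)
        hp'c).eq_zero_of_forall_exists_lintegral_le hlog0 ENNReal.ofReal_ne_top fun ε hε => by
          obtain ⟨f, g, hf, hg, hfg, h⟩ := hsmall ε hε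
          refine ⟨g, f, hg, hf, fun x => (hfg x).symm,
            (setLIntegral_le_lintegral _ _).trans ?_, ?_⟩ <;>
            rw [lintegral_smul_measure, smul_eq_mul]
          · exact le_add_self.trans h
          · exact (le_self_add.trans (le_self_add.trans le_self_add)).trans h
      simpa [hα1, hα.2.not_ge] using h0
    refine ⟨Measure.eq_of_smul_add_smul_eq hS hα0 ENNReal.ofReal_ne_top hqrS hqcS hpr hpc hmixeq,
      Measure.eq_of_smul_add_smul_eq hS.compl hα1 ENNReal.ofReal_ne_top (b := ENNReal.ofReal α)
        (by rwa [compl_compl]) hqrS (by rwa [compl_compl]) hpr ?_⟩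
    rw [add_comm, hmixeq, add_comm]
  · rintro ⟨rfl, rfl⟩
    refine ⟨rfl, ?_⟩
    have hr (μ : Measure X) (hμ : μ Sᶜ = 0) :
        ∫⁻ x, nl (S.indicator (fun _ => (1 : ℝ)) x) ∂μ = 0 := by
      refine lintegral_eq_zero_of_ae_eq_zero ?_
      filter_upwards [compl_mem_ae_iff.2 hμ] with x hx
      simp [not_not.1 hx, hnl1]
    have hc (μ : Measure X) (hμ : μ S = 0) :
        ∫⁻ x, nl (1 - S.indicator (fun _ => (1 : ℝ)) x) ∂μ = 0 := by
      refine lintegral_eq_zero_of_ae_eq_zero ?_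
      filter_upwards [compl_mem_ae_iff.2 hμ] with x hx
      simp [Set.indicator_of_notMem hx, hnl1]
    rw [hI]
    refine le_antisymm (iInf₂_le_of_le (S.indicator fun _ => (1 : ℝ))
      ⟨measurable_const.indicator hS, fun x => ?_⟩ ?_) zero_le
    · by_cases hx : x ∈ S <;> simp [hx]
    · simp [hr _ hp'r, hr _ hpr, hc _ hp'c, hc _ hpc]
end
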